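/- Let 3 ≤ p ≤ q be positive integers and suppose the quadratic polynomial x² − (q+3)x + (pq+2) has two integer roots p'' ≤ q'' with p'' ≥ 2. Then every finite simple graph cospectral with K_{p,q}^+ is isomorphic either to K_{p,q}^+ itself or to K_{p'',q''}^- ∪ (p−2)K_1, the disjoint union of K_{p'',q''}^- with p−2 isolated vertices; moreover K_{p'',q''}^- ∪ (p−2)K_1 is cospectral with and not isomorphic to K_{p,q}^+. -/

import Mathlib

open SimpleGraph Polynomial Matrix

universe u

/-- The graph `K_{p,q}⁻`, obtained from the complete bipartite graph `K_{p,q}`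
by deleting one edge (the edge between the first vertex of each part). -/
def KpqMinus (p q : ℕ) : SimpleGraph (Fin p ⊕ Fin q) :=
  SimpleGraph.fromRel fun u v =>
    ∃ (i : Fin p) (j : Fin q), u = Sum.inl i ∧ v = Sum.inr j ∧ ¬(i.val = 0 ∧ j.val = 0)

/-- The graph `K_{p,q}⁺`, obtained from the complete bipartite graph `K_{p,q}`
by adding a new vertex `x` together with a new edge `xy`, where `y` is a vertex
in the partite set of order `p`. -/
def KpqPlus (p q : ℕ) : SimpleGraph ((Fin p ⊕ Fin q) ⊕ Unit) :=
  SimpleGraph.fromRel fun u v =>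
    (∃ (i : Fin p) (j : Fin q), u = Sum.inl (Sum.inl i) ∧ v = Sum.inl (Sum.inr j)) ∨
    (∃ i : Fin p, i.val = 0 ∧ u = Sum.inl (Sum.inl i) ∧ v = Sum.inr ())

/-- The disjoint union of a graph `G` with `m` isolated vertices. -/
def addIsolated {V : Type*} (G : SimpleGraph V) (m : ℕ) : SimpleGraph (V ⊕ Fin m) :=
  SimpleGraph.fromRel fun u v => ∃ a b, u = Sum.inl a ∧ v = Sum.inl b ∧ G.Adj a b

open scoped Classical in
/-- The real adjacency matrix of a finite simple graph. -/
noncomputable def adjMat {V : Type*} [Fintype V] [DecidableEq V] (G : SimpleGraph V) :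
    Matrix V V ℝ :=
  Matrix.of fun i j => if G.Adj i j then (1 : ℝ) else 0

/-- Two finite simple graphs are cospectral if their adjacency matrices have the same
characteristic polynomial. -/
def Cospectral {V W : Type*} [Fintype V] [DecidableEq V] [Fintype W] [DecidableEq W]
    (G : SimpleGraph V) (H : SimpleGraph W) : Prop :=
  (adjMat G).charpoly = (adjMat H).charpoly

/-- A finite simple graph is determined by its spectrum (DS) if every graph cospectral
with it is isomorphic to it. -/
def IsDS {V : Type*} [Fintype V] [DecidableEq V] (G : SimpleGraph V) : Prop :=
  ∀ (W : Type u) [Fintype W] [DecidableEq W] (H : SimpleGraph W),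
    Cospectral G H → Nonempty (G ≃g H)

/-- The spectral radius of a finite simple graph: the largest eigenvalue of its
adjacency matrix. -/
noncomputable def specRadius {V : Type*} [Fintype V] [DecidableEq V]
    (G : SimpleGraph V) : ℝ :=
  sSup {x : ℝ | ∃ v : V → ℝ, v ≠ 0 ∧ (adjMat G).mulVec v = x • v}

/-- A graph is bipartite if its vertex set can be partitioned into two parts such that
every edge joins a vertex of one part to a vertex of the other. -/
def IsBipartite {V : Type*} (G : SimpleGraph V) : Prop :=
  ∃ s : Set V, ∀ a b, G.Adj a b → (a ∈ s ∧ b ∉ s) ∨ (a ∉ s ∧ b ∈ s)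

section Spectrum

theorem Matrix.det_submatrix_eq_zero_of_rank_lt {V W : Type*} [Fintype W]
    {A : Matrix V W ℝ} {n : ℕ} (hA : A.rank < n) (r : Fin n → V) (c : Fin n → W) :
    (A.submatrix r c).det = 0 := by
  by_contra h
  have h1 := Matrix.rank_of_isUnit _
    ((Matrix.isUnit_iff_isUnit_det (A.submatrix r c)).2 (isUnit_iff_ne_zero.2 h))
  have h2 := Matrix.rank_submatrix_le A r c
  simp at h1
  omega

variable {V : Type*} [Fintype V] [DecidableEq V] {W : Type*} [Fintype W] [DecidableEq W]

theorem adjMat_symm (G : SimpleGraph V) (u v : V) : adjMat G u v = adjMat G v u := by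
  by_cases h : G.Adj u v
  · simp [adjMat, h, h.symm]
  · simp [adjMat, h, mt G.adj_symm h]

theorem adjMat_nonneg (G : SimpleGraph V) (u v : V) : 0 ≤ adjMat G u v := by
  by_cases h : G.Adj u v <;> simp [adjMat, h]

theorem adjMat_isHermitian (G : SimpleGraph V) : (adjMat G).IsHermitian := by
  ext u v
  simp [adjMat_symm G v u]

theorem Matrix.IsHermitian.rank_eq_countP_roots {A : Matrix V V ℝ} (hA : A.IsHermitian) :
    A.rank = A.charpoly.roots.countP (· ≠ 0) := by
  rw [hA.rank_eq_card_non_zero_eigs, hA.roots_charpoly_eq_eigenvalues, Multiset.countP_map,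
    Fintype.card_subtype]
  simp [Finset.card]

theorem Matrix.IsHermitian.trace_pow_eq_sum_roots {A : Matrix V V ℝ} (hA : A.IsHermitian)
    (k : ℕ) : (A ^ k).trace = (A.charpoly.roots.map (· ^ k)).sum := by
  conv_lhs => rw [hA.spectral_theorem, ← map_pow, Unitary.conjStarAlgAut_apply,
    Matrix.trace_mul_comm, ← mul_assoc]
  simp [hA.roots_charpoly_eq_eigenvalues, Matrix.diagonal_pow, Matrix.trace_diagonal]

theorem Cospectral.rank_eq {G : SimpleGraph V} {H : SimpleGraph W} (h : Cospectral G H) :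
    (adjMat G).rank = (adjMat H).rank := by
  rw [(adjMat_isHermitian G).rank_eq_countP_roots, (adjMat_isHermitian H).rank_eq_countP_roots, h]

theorem Cospectral.trace_pow_eq {G : SimpleGraph V} {H : SimpleGraph W} (h : Cospectral G H)
    (k : ℕ) : (adjMat G ^ k).trace = (adjMat H ^ k).trace := by
  rw [(adjMat_isHermitian G).trace_pow_eq_sum_roots,
    (adjMat_isHermitian H).trace_pow_eq_sum_roots, h]

theorem trace_adjMat_pow_three (G : SimpleGraph V) :
    (adjMat G ^ 3).trace = ∑ u, ∑ v, ∑ w, adjMat G u w * adjMat G w v * adjMat G v u := by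
  simp [pow_succ, Matrix.trace, Matrix.mul_apply, Finset.sum_mul]

theorem trace_adjMat_pow_three_eq_zero_iff (G : SimpleGraph V) :
    (adjMat G ^ 3).trace = 0 ↔ ∀ u v w, G.Adj u v → G.Adj v w → ¬ G.Adj w u := by
  have h0 : ∀ u v w, 0 ≤ adjMat G u w * adjMat G w v * adjMat G v u := fun u v w =>
    mul_nonneg (mul_nonneg (adjMat_nonneg _ _ _) (adjMat_nonneg _ _ _)) (adjMat_nonneg _ _ _)
  rw [trace_adjMat_pow_three, Finset.sum_eq_zero_iff_of_nonneg
    fun u _ => Finset.sum_nonneg fun v _ => Finset.sum_nonneg fun w _ => h0 u v w]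
  constructor
  · intro h u v w huv hvw hwu
    have h1 := (Finset.sum_eq_zero_iff_of_nonneg
      fun v _ => Finset.sum_nonneg fun w _ => h0 u v w).1 (h u (Finset.mem_univ _)) w
      (Finset.mem_univ _)
    have h2 := (Finset.sum_eq_zero_iff_of_nonneg fun v _ => h0 u w v).1 h1 v (Finset.mem_univ _)
    simp [adjMat, huv, hvw, hwu] at h2
  · intro h u _
    refine Finset.sum_eq_zero fun v _ => Finset.sum_eq_zero fun w _ => ?_
    by_cases h1 : G.Adj u w <;> by_cases h2 : G.Adj w v <;> by_cases h3 : G.Adj v u <;>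
      simp [adjMat, h1, h2, h3]
    exact h u w v h1 h2 h3

end Spectrum

section Blowup

/-- Adjacency in the path `0 - 1 - 2 - 3 - 4` together with the isolated vertex `5`. -/
def PathAdj (i j : Fin 6) : Prop :=
  (i.val + 1 = j.val ∧ j.val < 5) ∨ (j.val + 1 = i.val ∧ i.val < 5)

instance : DecidableRel PathAdj := fun i j => by unfold PathAdj; infer_instance

/-- The graph `G` arises from the path `0 - 1 - 2 - 3 - 4` and an isolated vertex `5` by
replacing each vertex `i` by `k i` independent twins. -/
def IsPathBlowup {V : Type*} [Fintype V] (G : SimpleGraph V) (k : Fin 6 → ℕ) : Prop :=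
  ∃ f : V → Fin 6, (∀ u v, G.Adj u v ↔ PathAdj (f u) (f v)) ∧
    ∀ i, (Finset.univ.filter fun v => f v = i).card = k i

variable {V : Type*} [Fintype V] {W : Type*} [Fintype W]

theorem IsPathBlowup.nonempty_iso {G : SimpleGraph V} {H : SimpleGraph W} {k : Fin 6 → ℕ}
    (hG : IsPathBlowup G k) (hH : IsPathBlowup H k) : Nonempty (G ≃g H) := by
  obtain ⟨f, hf, hfk⟩ := hG
  obtain ⟨g, hg, hgk⟩ := hH
  have hcard : ∀ i, Fintype.card {v // f v = i} = Fintype.card {w // g w = i} := fun i => by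
    rw [Fintype.card_subtype, Fintype.card_subtype, hfk, hgk]
  refine ⟨⟨Equiv.ofFiberEquiv fun i => Fintype.equivOfCardEq (hcard i), fun {u v} => ?_⟩⟩
  rw [hg, hf, Equiv.ofFiberEquiv_map (g := g), Equiv.ofFiberEquiv_map (g := g)]

theorem IsPathBlowup.comp_perm {G : SimpleGraph V} {k : Fin 6 → ℕ} (hG : IsPathBlowup G k)
    (σ : Equiv.Perm (Fin 6))
    (hσ : ∀ i j, k i ≠ 0 → k j ≠ 0 → (PathAdj (σ i) (σ j) ↔ PathAdj i j)) :
    IsPathBlowup G (k ∘ σ.symm) := by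
  obtain ⟨f, hf, hfk⟩ := hG
  have h0 : ∀ v, k (f v) ≠ 0 := fun v => by
    rw [← hfk]
    exact Finset.card_ne_zero_of_mem (a := v) (by simp)
  refine ⟨σ ∘ f, fun u v => ?_, fun i => ?_⟩
  · rw [hf, Function.comp_apply, Function.comp_apply, hσ _ _ (h0 u) (h0 v)]
  · rw [Function.comp_apply, ← hfk]
    congr 1
    ext v
    simp [Equiv.eq_symm_apply]

theorem IsPathBlowup.reverse {G : SimpleGraph V} {a m c n b i : ℕ}
    (hG : IsPathBlowup G ![a, m, c, n, b, i]) : IsPathBlowup G ![b, n, c, m, a, i] := by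
  have hσ : ∀ i j, PathAdj ((Equiv.swap 0 4 * Equiv.swap 1 3 : Equiv.Perm (Fin 6)) i)
      ((Equiv.swap 0 4 * Equiv.swap 1 3 : Equiv.Perm (Fin 6)) j) ↔ PathAdj i j := by decide
  have h := hG.comp_perm _ fun i j _ _ => hσ i j
  convert h using 1
  ext j
  fin_cases j <;> rfl

theorem IsPathBlowup.reverse_of_eq_zero {G : SimpleGraph V} {m c n b i : ℕ}
    (hG : IsPathBlowup G ![0, m, c, n, b, i]) : IsPathBlowup G ![0, b, n, c, m, i] := by
  have hσ : ∀ i j, i ≠ 0 → j ≠ 0 →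
      (PathAdj ((Equiv.swap 1 4 * Equiv.swap 2 3 : Equiv.Perm (Fin 6)) i)
        ((Equiv.swap 1 4 * Equiv.swap 2 3 : Equiv.Perm (Fin 6)) j) ↔ PathAdj i j) := by decide
  have h := hG.comp_perm _ fun i j hi hj =>
    hσ i j (by rintro rfl; exact hi rfl) (by rintro rfl; exact hj rfl)
  convert h using 1
  ext j
  fin_cases j <;> rfl

theorem IsPathBlowup.card_eq {G : SimpleGraph V} {k : Fin 6 → ℕ} (hG : IsPathBlowup G k) :
    Fintype.card V = ∑ i, k i := by
  obtain ⟨f, -, hfk⟩ := hG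
  simp_rw [← hfk]
  rw [← Finset.card_univ]
  exact Finset.card_eq_sum_card_fiberwise (by simp)

theorem IsPathBlowup.not_adj_of_adj_adj {G : SimpleGraph V} {k : Fin 6 → ℕ}
    (hG : IsPathBlowup G k) (u v w : V) (huv : G.Adj u v) (hvw : G.Adj v w) : ¬ G.Adj w u := by
  obtain ⟨f, hf, -⟩ := hG
  rw [hf] at *
  unfold PathAdj at *
  omega

/-- The left factor of a rank factorization of the adjacency matrix of the path on five vertices
together with an isolated vertex. -/
def pathLeft : Matrix (Fin 6) (Fin 4) ℝ :=
  !![1, 0, 0, 0; 0, 0, 1, 0; 1, 1, 0, 0; 0, 0, 0, 1; 0, 1, 0, 0; 0, 0, 0, 0]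

/-- The right factor of a rank factorization of the adjacency matrix of the path on five vertices
together with an isolated vertex. -/
def pathRight : Matrix (Fin 4) (Fin 6) ℝ :=
  !![0, 1, 0, 0, 0, 0; 0, 0, 0, 1, 0, 0; 1, 0, 1, 0, 0, 0; 0, 0, 1, 0, 1, 0]

theorem pathLeft_mul_pathRight (i j : Fin 6) :
    (pathLeft * pathRight) i j = if PathAdj i j then 1 else 0 := by
  fin_cases i <;> fin_cases j <;>
    simp [pathLeft, pathRight, PathAdj, Matrix.mul_apply, Fin.sum_univ_four]

variable [DecidableEq V] [DecidableEq W]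

theorem adjMat_eq_of_pathAdj {G : SimpleGraph V} {f : V → Fin 6}
    (hf : ∀ u v, G.Adj u v ↔ PathAdj (f u) (f v)) :
    adjMat G = pathLeft.submatrix f id * pathRight.submatrix id f := by
  ext u v
  have h := pathLeft_mul_pathRight (f u) (f v)
  simp only [Matrix.mul_apply] at h
  simp [Matrix.mul_apply, h, adjMat, hf]

theorem IsPathBlowup.rank_le {G : SimpleGraph V} {k : Fin 6 → ℕ} (hG : IsPathBlowup G k) :
    (adjMat G).rank ≤ 4 := by
  obtain ⟨f, hf, -⟩ := hG
  rw [adjMat_eq_of_pathAdj hf]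
  exact (Matrix.rank_mul_le_left _ _).trans (Matrix.rank_le_card_width _)

theorem IsPathBlowup.charpoly_eq {G : SimpleGraph V} {a m c n b i : ℕ}
    (hG : IsPathBlowup G ![a, m, c, n, b, i]) :
    X ^ 4 * (adjMat G).charpoly = X ^ (a + m + c + n + b + i) *
      (X ^ 4 - C (((a + c) * m + (b + c) * n : ℕ) : ℝ) * X ^ 2
        + C ((m * n * (a * b + a * c + b * c) : ℕ) : ℝ)) := by
  have hcard : Fintype.card V = a + m + c + n + b + i := by
    simp [hG.card_eq, Fin.sum_univ_six]
  obtain ⟨f, hf, hfk⟩ := hG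
  have hprod : pathRight.submatrix id f * pathLeft.submatrix f id =
      !![0, 0, (m : ℝ), 0; 0, 0, 0, (n : ℝ); (a + c : ℝ), (c : ℝ), 0, 0;
        (c : ℝ), (b + c : ℝ), 0, 0] := by
    have key : ∀ r s, (pathRight.submatrix id f * pathLeft.submatrix f id) r s =
        ∑ t, ((![a, m, c, n, b, i] t : ℕ) : ℝ) * (pathRight r t * pathLeft t s) := fun r s => by
      rw [Matrix.mul_apply]
      simp only [Matrix.submatrix_apply, id]
      rw [← Finset.sum_fiberwise' Finset.univ f fun t => pathRight r t * pathLeft t s]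
      simp [hfk]
    ext r s
    rw [key]
    fin_cases r <;> fin_cases s <;>
      simp [pathLeft, pathRight, Fin.sum_univ_six, add_comm]
  have h := Matrix.charpoly_mul_comm' (pathLeft.submatrix f id) (pathRight.submatrix id f)
  rw [hprod, ← adjMat_eq_of_pathAdj hf, hcard, Fintype.card_fin] at h
  rw [h]
  congr 1
  simp [Matrix.charpoly, Matrix.charmatrix, Matrix.det_succ_row_zero, Fin.sum_univ_succ, Fin.succAbove]
  ring

end Blowup

section Structure

/-- The vertices `x₁, x₂, x₃, x₄` induce two disjoint edges `x₁x₂` and `x₃x₄`. -/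
structure IsTwoEdges {V : Type*} (G : SimpleGraph V) (x₁ x₂ x₃ x₄ : V) : Prop where
  adj₁₂ : G.Adj x₁ x₂
  adj₃₄ : G.Adj x₃ x₄
  not_adj₁₃ : ¬ G.Adj x₁ x₃
  not_adj₁₄ : ¬ G.Adj x₁ x₄
  not_adj₂₃ : ¬ G.Adj x₂ x₃
  not_adj₂₄ : ¬ G.Adj x₂ x₄

/-- The vertices `x₁, x₂, x₃, x₄` induce the path `x₁x₂x₃x₄`. -/
structure IsPathFour {V : Type*} (G : SimpleGraph V) (x₁ x₂ x₃ x₄ : V) : Prop where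
  adj₁₂ : G.Adj x₁ x₂
  adj₂₃ : G.Adj x₂ x₃
  adj₃₄ : G.Adj x₃ x₄
  not_adj₁₃ : ¬ G.Adj x₁ x₃
  not_adj₁₄ : ¬ G.Adj x₁ x₄
  not_adj₂₄ : ¬ G.Adj x₂ x₄

theorem IsTwoEdges.swap_right {V : Type*} {G : SimpleGraph V} {x₁ x₂ x₃ x₄ : V}
    (hx : IsTwoEdges G x₁ x₂ x₃ x₄) :
    IsTwoEdges G x₁ x₂ x₄ x₃ :=
  ⟨hx.adj₁₂, hx.adj₃₄.symm, hx.not_adj₁₄, hx.not_adj₁₃, hx.not_adj₂₄, hx.not_adj₂₃⟩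

theorem IsTwoEdges.swap_left {V : Type*} {G : SimpleGraph V} {x₁ x₂ x₃ x₄ : V}
    (hx : IsTwoEdges G x₁ x₂ x₃ x₄) :
    IsTwoEdges G x₂ x₁ x₃ x₄ :=
  ⟨hx.adj₁₂.symm, hx.adj₃₄, hx.not_adj₂₃, hx.not_adj₂₄, hx.not_adj₁₃, hx.not_adj₁₄⟩

variable {V : Type*} [Fintype V] [DecidableEq V] {G : SimpleGraph V}

theorem IsPathBlowup.of_pathAdj {V : Type*} [Fintype V] {G : SimpleGraph V} {f : V → Fin 6}
    (hf : ∀ u v, G.Adj u v ↔ PathAdj (f u) (f v)) :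
    ∃ a m c n b i, IsPathBlowup G ![a, m, c, n, b, i] := by
  let k : Fin 6 → ℕ := fun i => (Finset.univ.filter fun v => f v = i).card
  refine ⟨k 0, k 1, k 2, k 3, k 4, k 5, f, hf, fun i => ?_⟩
  fin_cases i <;> rfl

theorem IsTwoEdges.adjMat_eq {x₁ x₂ x₃ x₄ : V} (hx : IsTwoEdges G x₁ x₂ x₃ x₄)
    (hG : (adjMat G).rank ≤ 4) (u v : V) :
    adjMat G u v = adjMat G u x₁ * adjMat G v x₂ + adjMat G u x₂ * adjMat G v x₁ +
      adjMat G u x₃ * adjMat G v x₄ + adjMat G u x₄ * adjMat G v x₃ := by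
  obtain ⟨h12, h34, h13, h14, h23, h24⟩ := hx
  have h := Matrix.det_submatrix_eq_zero_of_rank_lt (Nat.lt_succ_of_le hG)
    ![x₁, x₂, x₃, x₄, u] ![x₁, x₂, x₃, x₄, v]
  have hM : (adjMat G).submatrix ![x₁, x₂, x₃, x₄, u] ![x₁, x₂, x₃, x₄, v] =
      !![0, 1, 0, 0, adjMat G x₁ v; 1, 0, 0, 0, adjMat G x₂ v; 0, 0, 0, 1, adjMat G x₃ v;
        0, 0, 1, 0, adjMat G x₄ v;
        adjMat G u x₁, adjMat G u x₂, adjMat G u x₃, adjMat G u x₄, adjMat G u v] := by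
    ext i j
    fin_cases i <;> fin_cases j <;>
      simp [adjMat, h12, h34, h13, h14, h23, h24, h12.symm, h34.symm, G.adj_comm x₃ x₁,
        G.adj_comm x₄ x₁, G.adj_comm x₃ x₂, G.adj_comm x₄ x₂]
  rw [hM] at h
  simp [Matrix.det_succ_row_zero, Fin.sum_univ_succ, Fin.succAbove] at h
  rw [adjMat_symm G v x₁, adjMat_symm G v x₂, adjMat_symm G v x₃, adjMat_symm G v x₄]
  linarith

theorem IsPathFour.adjMat_eq {x₁ x₂ x₃ x₄ : V} (hx : IsPathFour G x₁ x₂ x₃ x₄)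
    (hG : (adjMat G).rank ≤ 4) (u v : V) :
    adjMat G u v = adjMat G v x₁ * (adjMat G u x₂ - adjMat G u x₄) +
      adjMat G v x₂ * adjMat G u x₁ + adjMat G v x₃ * adjMat G u x₄ +
      adjMat G v x₄ * (adjMat G u x₃ - adjMat G u x₁) := by
  obtain ⟨h12, h23, h34, h13, h14, h24⟩ := hx
  have h := Matrix.det_submatrix_eq_zero_of_rank_lt (Nat.lt_succ_of_le hG)
    ![x₁, x₂, x₃, x₄, u] ![x₁, x₂, x₃, x₄, v]
  have hM : (adjMat G).submatrix ![x₁, x₂, x₃, x₄, u] ![x₁, x₂, x₃, x₄, v] =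
      !![0, 1, 0, 0, adjMat G x₁ v; 1, 0, 1, 0, adjMat G x₂ v; 0, 1, 0, 1, adjMat G x₃ v;
        0, 0, 1, 0, adjMat G x₄ v;
        adjMat G u x₁, adjMat G u x₂, adjMat G u x₃, adjMat G u x₄, adjMat G u v] := by
    ext i j
    fin_cases i <;> fin_cases j <;>
      simp [adjMat, h12, h34, h13, h14, h23, h24, h12.symm, h34.symm, h23.symm, G.adj_comm x₃ x₁,
        G.adj_comm x₄ x₁, G.adj_comm x₄ x₂]
  rw [hM] at h
  simp [Matrix.det_succ_row_zero, Fin.sum_univ_succ, Fin.succAbove] at h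
  rw [adjMat_symm G v x₁, adjMat_symm G v x₂, adjMat_symm G v x₃, adjMat_symm G v x₄]
  linarith

open scoped Classical in
theorem IsTwoEdges.exists_isPathBlowup_of_forall_not_adj {x₁ x₂ x₃ x₄ : V}
    (hx : IsTwoEdges G x₁ x₂ x₃ x₄) (hG : (adjMat G).rank ≤ 4)
    (hT : ∀ u v w, G.Adj u v → G.Adj v w → ¬ G.Adj w u)
    (h14 : ∀ u, G.Adj u x₁ → ¬ G.Adj u x₄) (h2 : ∀ u, G.Adj u x₂ → ¬ G.Adj u x₃ ∧ ¬ G.Adj u x₄) :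
    ∃ a m c n b i, IsPathBlowup G ![a, m, c, n, b, i] := by
  refine IsPathBlowup.of_pathAdj (f := fun u =>
    if G.Adj u x₁ then if G.Adj u x₃ then 2 else 0
    else if G.Adj u x₂ then 1 else if G.Adj u x₄ then 3 else if G.Adj u x₃ then 4 else 5) ?_
  have htype : ∀ u, (¬ (G.Adj u x₁ ∧ G.Adj u x₂)) ∧ ¬ (G.Adj u x₃ ∧ G.Adj u x₄) := fun u =>
    ⟨fun h => hT _ _ _ h.1 hx.adj₁₂ h.2.symm, fun h => hT _ _ _ h.1 hx.adj₃₄ h.2.symm⟩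
  intro u v
  have h := hx.adjMat_eq hG u v
  have hu := htype u
  have hv := htype v
  have hu' := h14 u
  have hv' := h14 v
  have hu'' := h2 u
  have hv'' := h2 v
  simp only [adjMat, Matrix.of_apply] at h
  by_cases a1 : G.Adj u x₁ <;> by_cases a2 : G.Adj u x₂ <;> by_cases a3 : G.Adj u x₃ <;>
    by_cases a4 : G.Adj u x₄ <;> simp [a1, a2, a3, a4] at hu hu' hu'' <;>
    by_cases b1 : G.Adj v x₁ <;> by_cases b2 : G.Adj v x₂ <;> by_cases b3 : G.Adj v x₃ <;>
    by_cases b4 : G.Adj v x₄ <;> simp [b1, b2, b3, b4] at hv hv' hv'' <;>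
    simp [a1, a2, a3, a4, b1, b2, b3, b4] at h ⊢ <;> simp [h, PathAdj]

theorem IsTwoEdges.exists_isPathBlowup_of_adj {x₁ x₂ x₃ x₄ u : V}
    (hx : IsTwoEdges G x₁ x₂ x₃ x₄) (hG : (adjMat G).rank ≤ 4)
    (hT : ∀ u v w, G.Adj u v → G.Adj v w → ¬ G.Adj w u) (h1 : G.Adj u x₁) (h3 : G.Adj u x₃) :
    ∃ a m c n b i, IsPathBlowup G ![a, m, c, n, b, i] := by
  have h2 : ¬ G.Adj u x₂ := fun h => hT _ _ _ h1 hx.adj₁₂ h.symm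
  have h4 : ¬ G.Adj u x₄ := fun h => hT _ _ _ h3 hx.adj₃₄ h.symm
  have key : ∀ v, adjMat G u v = adjMat G v x₂ + adjMat G v x₄ := fun v => by
    rw [hx.adjMat_eq hG u v]
    simp [adjMat, h1, h2, h3, h4]
  refine hx.exists_isPathBlowup_of_forall_not_adj hG hT (fun v hv1 hv4 => ?_)
    fun v hv2 => ⟨fun hv3 => ?_, fun hv4 => ?_⟩
  · have hv2 : ¬ G.Adj v x₂ := fun h => hT _ _ _ hv1 hx.adj₁₂ h.symm
    have hk := key v
    by_cases huv : G.Adj u v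
    · exact hT _ _ _ huv hv1 h1.symm
    · simp [adjMat, hv2, hv4, huv] at hk
  · have hv4 : ¬ G.Adj v x₄ := fun h => hT _ _ _ hv3 hx.adj₃₄ h.symm
    have hk := key v
    by_cases huv : G.Adj u v
    · exact hT _ _ _ huv hv3 h3.symm
    · simp [adjMat, hv2, hv4, huv] at hk
  · have hk := key v
    by_cases huv : G.Adj u v <;> simp [adjMat, hv2, hv4, huv] at hk
    norm_num at hk

theorem IsTwoEdges.exists_isPathBlowup {x₁ x₂ x₃ x₄ : V}
    (hx : IsTwoEdges G x₁ x₂ x₃ x₄) (hG : (adjMat G).rank ≤ 4)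
    (hT : ∀ u v w, G.Adj u v → G.Adj v w → ¬ G.Adj w u) :
    ∃ a m c n b i, IsPathBlowup G ![a, m, c, n, b, i] := by
  by_cases h14 : ∃ u, G.Adj u x₁ ∧ G.Adj u x₄
  · obtain ⟨u, h, h'⟩ := h14
    exact hx.swap_right.exists_isPathBlowup_of_adj hG hT h h'
  by_cases h23 : ∃ u, G.Adj u x₂ ∧ G.Adj u x₃
  · obtain ⟨u, h, h'⟩ := h23
    exact hx.swap_left.exists_isPathBlowup_of_adj hG hT h h'
  by_cases h24 : ∃ u, G.Adj u x₂ ∧ G.Adj u x₄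
  · obtain ⟨u, h, h'⟩ := h24
    exact hx.swap_left.swap_right.exists_isPathBlowup_of_adj hG hT h h'
  push Not at h14 h23 h24
  exact hx.exists_isPathBlowup_of_forall_not_adj hG hT h14 fun u hu => ⟨h23 u hu, h24 u hu⟩

open scoped Classical in
theorem IsPathFour.exists_isPathBlowup {x₁ x₂ x₃ x₄ : V}
    (hx : IsPathFour G x₁ x₂ x₃ x₄) (hG : (adjMat G).rank ≤ 4)
    (hT : ∀ u v w, G.Adj u v → G.Adj v w → ¬ G.Adj w u)
    (hE : ∀ y₁ y₂ y₃ y₄, ¬ IsTwoEdges G y₁ y₂ y₃ y₄) :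
    ∃ a m c n b i, IsPathBlowup G ![a, m, c, n, b, i] := by
  refine IsPathBlowup.of_pathAdj (f := fun u =>
    if G.Adj u x₁ then 2 else if G.Adj u x₄ then 3 else if G.Adj u x₂ then 1
    else if G.Adj u x₃ then 4 else 5) ?_
  have h12 : ∀ u, G.Adj u x₁ → ¬ G.Adj u x₂ := fun u h h' => hT _ _ _ h hx.adj₁₂ h'.symm
  have h23 : ∀ u, G.Adj u x₂ → ¬ G.Adj u x₃ := fun u h h' => hT _ _ _ h hx.adj₂₃ h'.symm
  have h34 : ∀ u, G.Adj u x₃ → ¬ G.Adj u x₄ := fun u h h' => hT _ _ _ h hx.adj₃₄ h'.symm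
  have h14 : ∀ u, G.Adj u x₁ → ¬ G.Adj u x₄ := fun u h h' => by
    have := hx.adjMat_eq hG u u
    have h2 := h12 u h
    have h3 : ¬ G.Adj u x₃ := fun h3 => h34 u h3 h'
    simp [adjMat, h, h', h2, h3] at this
    norm_num at this
  have h13 : ∀ u, G.Adj u x₁ → G.Adj u x₃ := fun u h => by
    by_contra h3
    exact hE u x₁ x₃ x₄ ⟨h, hx.adj₃₄, h3, h14 u h, hx.not_adj₁₃, hx.not_adj₁₄⟩
  have h42 : ∀ u, G.Adj u x₄ → G.Adj u x₂ := fun u h => by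
    by_contra h3
    exact hE x₁ x₂ x₄ u ⟨hx.adj₁₂, h.symm, hx.not_adj₁₄, fun h1 => h14 u h1.symm h,
      hx.not_adj₂₄, fun h2 => h3 h2.symm⟩
  intro u v
  have h := hx.adjMat_eq hG u v
  simp only [adjMat, Matrix.of_apply] at h
  have hu12 := h12 u
  have hu23 := h23 u
  have hu34 := h34 u
  have hu14 := h14 u
  have hu13 := h13 u
  have hu42 := h42 u
  have hv12 := h12 v
  have hv23 := h23 v
  have hv34 := h34 v
  have hv14 := h14 v
  have hv13 := h13 v
  have hv42 := h42 v
  by_cases a1 : G.Adj u x₁ <;> by_cases a2 : G.Adj u x₂ <;> by_cases a3 : G.Adj u x₃ <;>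
    by_cases a4 : G.Adj u x₄ <;> simp [a1, a2, a3, a4] at hu12 hu23 hu34 hu14 hu13 hu42 <;>
    by_cases b1 : G.Adj v x₁ <;> by_cases b2 : G.Adj v x₂ <;> by_cases b3 : G.Adj v x₃ <;>
    by_cases b4 : G.Adj v x₄ <;> simp [b1, b2, b3, b4] at hv12 hv23 hv34 hv14 hv13 hv42 <;>
    simp [a1, a2, a3, a4, b1, b2, b3, b4] at h ⊢ <;> simp [h, PathAdj]

open scoped Classical in
theorem exists_isPathBlowup_of_not_isTwoEdges_of_not_isPathFour
    {V : Type*} [Fintype V] {G : SimpleGraph V}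
    (hT : ∀ u v w, G.Adj u v → G.Adj v w → ¬ G.Adj w u)
    (hE : ∀ y₁ y₂ y₃ y₄, ¬ IsTwoEdges G y₁ y₂ y₃ y₄)
    (hP : ∀ y₁ y₂ y₃ y₄, ¬ IsPathFour G y₁ y₂ y₃ y₄) :
    ∃ a m c n b i, IsPathBlowup G ![a, m, c, n, b, i] := by
  by_cases hxy : ∃ x y, G.Adj x y
  swap
  · push Not at hxy
    exact IsPathBlowup.of_pathAdj (f := fun _ => 5) (by simp [hxy, PathAdj])
  obtain ⟨x, y, hxy⟩ := hxy
  have h1 : ∀ u, G.Adj u x → ¬ G.Adj u y := fun u h h' => hT _ _ _ h hxy h'.symm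
  have h2 : ∀ u v, G.Adj u x → G.Adj v y → G.Adj u v := fun u v hu hv => by
    by_contra huv
    exact hP u x y v ⟨hu, hxy, hv.symm, h1 u hu, huv, fun h => h1 v h.symm hv⟩
  have h3 : ∀ u v, G.Adj u v → G.Adj u x ∨ G.Adj u y := fun u v huv => by
    by_contra! hu
    by_cases hvx : G.Adj v x
    · exact hP u v x y ⟨huv, hvx, hxy, hu.1, hu.2, h1 v hvx⟩
    by_cases hvy : G.Adj v y
    · exact hP u v y x ⟨huv, hvy, hxy.symm, hu.2, hu.1, hvx⟩
    exact hE u v x y ⟨huv, hxy, hu.1, hu.2, hvx, hvy⟩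
  refine IsPathBlowup.of_pathAdj (f := fun u =>
    if G.Adj u x then 1 else if G.Adj u y then 2 else 5) fun u v => ?_
  by_cases hux : G.Adj u x
  · have huy := h1 u hux
    by_cases hvx : G.Adj v x
    · have huv : ¬ G.Adj u v := fun h => hT _ _ _ h hvx hux.symm
      simp [hux, hvx, huv, PathAdj]
    by_cases hvy : G.Adj v y
    · simp [hux, hvx, hvy, h2 u v hux hvy, PathAdj]
    have huv : ¬ G.Adj u v := fun h => (h3 v u h.symm).elim hvx hvy
    simp [hux, hvx, hvy, huv, PathAdj]
  by_cases huy : G.Adj u y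
  · by_cases hvx : G.Adj v x
    · simp [hux, hvx, huy, (h2 v u hvx huy).symm, PathAdj]
    by_cases hvy : G.Adj v y
    · have huv : ¬ G.Adj u v := fun h => hT _ _ _ h hvy huy.symm
      simp [hux, hvx, hvy, huy, huv, PathAdj]
    have huv : ¬ G.Adj u v := fun h => (h3 v u h.symm).elim hvx hvy
    simp [hux, huy, hvx, hvy, huv, PathAdj]
  have huv : ¬ G.Adj u v := fun h => (h3 u v h).elim hux huy
  simp only [hux, huy, huv, if_false, false_iff]
  split_ifs <;> simp [PathAdj]

theorem exists_isPathBlowup_of_rank_le (hG : (adjMat G).rank ≤ 4)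
    (hT : ∀ u v w, G.Adj u v → G.Adj v w → ¬ G.Adj w u) :
    ∃ a m c n b i, IsPathBlowup G ![a, m, c, n, b, i] := by
  by_cases hE : ∃ y₁ y₂ y₃ y₄, IsTwoEdges G y₁ y₂ y₃ y₄
  · obtain ⟨_, _, _, _, h⟩ := hE
    exact h.exists_isPathBlowup hG hT
  by_cases hP : ∃ y₁ y₂ y₃ y₄, IsPathFour G y₁ y₂ y₃ y₄
  · obtain ⟨_, _, _, _, h⟩ := hP
    exact h.exists_isPathBlowup hG hT (by simpa using hE)
  exact exists_isPathBlowup_of_not_isTwoEdges_of_not_isPathFour hT (by simpa using hE)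
    (by simpa using hP)

end Structure

section Characterization

variable {V : Type*} [Fintype V] [DecidableEq V] {W : Type*} [Fintype W] [DecidableEq W]

theorem natDegree_biquadratic (t s : ℝ) :
    (X ^ 4 - C t * X ^ 2 + C s : ℝ[X]).natDegree = 4 := by
  compute_degree!

theorem IsPathBlowup.cospectral_iff {G : SimpleGraph V} {H : SimpleGraph W}
    {a m c n b i a' m' c' n' b' i' : ℕ} (hG : IsPathBlowup G ![a, m, c, n, b, i])
    (hH : IsPathBlowup H ![a', m', c', n', b', i']) :
    Cospectral G H ↔ a + m + c + n + b + i = a' + m' + c' + n' + b' + i' ∧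
      (a + c) * m + (b + c) * n = (a' + c') * m' + (b' + c') * n' ∧
      m * n * (a * b + a * c + b * c) = m' * n' * (a' * b' + a' * c' + b' * c') := by
  have hX : ∀ k, (X ^ k : ℝ[X]) ≠ 0 := fun k => pow_ne_zero _ X_ne_zero
  rw [Cospectral, ← mul_right_inj' (hX 4), hG.charpoly_eq, hH.charpoly_eq]
  constructor
  · intro h
    have hne : ∀ t s : ℝ, (X ^ 4 - C t * X ^ 2 + C s : ℝ[X]) ≠ 0 := fun t s h0 => by
      have := natDegree_biquadratic t s
      simp [h0] at this
    have hdeg := congrArg natDegree h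
    rw [natDegree_mul (hX _) (hne _ _), natDegree_mul (hX _) (hne _ _), natDegree_biquadratic,
      natDegree_biquadratic, natDegree_X_pow, natDegree_X_pow, Nat.add_right_cancel_iff] at hdeg
    rw [hdeg, mul_right_inj' (hX _)] at h
    have h0 := congrArg (eval 0) h
    have h1 := congrArg (eval 1) h
    simp only [eval_add, eval_sub, eval_mul, eval_pow, eval_X, eval_C] at h0 h1
    refine ⟨hdeg, ?_, ?_⟩ <;> rify at * <;> linarith
  · rintro ⟨h1, h2, h3⟩
    rw [h1, h2, h3]

theorem isPathBlowup_KpqPlus (r q : ℕ) :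
    IsPathBlowup (KpqPlus (r + 1) q) ![0, 1, 1, q, r, 0] := by
  refine ⟨Sum.elim (Sum.elim (fun i => if i.val = 0 then 2 else 4) fun _ => 3) fun _ => 1,
    ?_, fun i => ?_⟩
  · rintro ((u | u) | u) ((v | v) | v) <;> simp [KpqPlus, PathAdj]
    all_goals split_ifs <;> simp_all
  · rw [Finset.card_filter]
    simp only [Fintype.sum_sum_type, Fin.sum_univ_succ]
    fin_cases i <;> simp

theorem isPathBlowup_addIsolated_KpqMinus (x y k : ℕ) :
    IsPathBlowup (addIsolated (KpqMinus (x + 1) (y + 1)) k) ![0, 1, y, x, 1, k] := by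
  refine ⟨Sum.elim (Sum.elim (fun i => if i.val = 0 then 1 else 3)
    fun j => if j.val = 0 then 4 else 2) fun _ => 5, ?_, fun i => ?_⟩
  · rintro ((u | u) | u) ((v | v) | v) <;> simp [KpqMinus, addIsolated, PathAdj]
    all_goals split_ifs <;> simp_all
  · rw [Finset.card_filter]
    simp only [Fintype.sum_sum_type, Fin.sum_univ_succ]
    fin_cases i <;> simp

theorem eq_zero_or_eq_zero_of_sum_eq_prod_add {q a m c n b : ℕ}
    (hs : 0 < m * n * (a * b + a * c + b * c))
    (ht : (a + c) * m + (b + c) * n = m * n * (a * b + a * c + b * c) + q + 1) (hq : 0 < q) :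
    a = 0 ∨ b = 0 := by
  by_contra! h
  have ha : 1 ≤ a := Nat.one_le_iff_ne_zero.2 h.1
  have hb : 1 ≤ b := Nat.one_le_iff_ne_zero.2 h.2
  have hmn := Nat.pos_of_mul_pos_right hs
  have hm : 1 ≤ m := Nat.pos_of_mul_pos_right hmn
  have hn : 1 ≤ n := Nat.pos_of_mul_pos_left hmn
  obtain ⟨a, rfl⟩ := Nat.exists_eq_add_of_le' ha
  obtain ⟨b, rfl⟩ := Nat.exists_eq_add_of_le' hb
  obtain ⟨m, rfl⟩ := Nat.exists_eq_add_of_le' hm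
  obtain ⟨n, rfl⟩ := Nat.exists_eq_add_of_le' hn
  zify at *
  have h1 : (0 : ℤ) ≤ ((a + 1) * (m + 1) - 1) * ((b + 1) * (n + 1) - 1) := by
    apply mul_nonneg <;> ring_nf <;> positivity
  have h2 : (0 : ℤ) ≤
      c * ((m + 1) * ((n + 1) * (a + 1) - 1) + (n + 1) * ((m + 1) * (b + 1) - 1)) := by
    ring_nf; positivity
  nlinarith

theorem eq_one_and_eq_of_two_le {q x y z : ℕ} (hq : 3 ≤ q) (hx : 1 ≤ x) (hy : 1 ≤ y) (hz : 2 ≤ z)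
    (ht : x + x * y + y * z = x * y * z + q + 1) : x = 1 ∧ y = q := by
  have hx1 : x = 1 := by
    by_contra hx1
    obtain ⟨x, rfl⟩ := Nat.exists_eq_add_of_le' (show 2 ≤ x by omega)
    obtain ⟨y, rfl⟩ := Nat.exists_eq_add_of_le' hy
    obtain ⟨z, rfl⟩ := Nat.exists_eq_add_of_le' hz
    ring_nf at ht
    linarith [Nat.zero_le (x * y), Nat.zero_le (x * y * z), Nat.zero_le (x * z),
      Nat.zero_le (y * z)]
  subst hx1
  exact ⟨rfl, by linarith⟩

theorem eq_one_or_eq_one_of_sum_eq_prod_add {q w x y z : ℕ} (hq : 0 < q) (hw : 1 ≤ w)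
    (hx : 1 ≤ x) (hy : 1 ≤ y) (hz : 1 ≤ z)
    (ht : w * x + x * y + y * z = w * x * y * z + q + 1) : w = 1 ∨ z = 1 := by
  by_contra! h
  obtain ⟨w, rfl⟩ := Nat.exists_eq_add_of_le' (show 2 ≤ w by omega)
  obtain ⟨z, rfl⟩ := Nat.exists_eq_add_of_le' (show 2 ≤ z by omega)
  obtain ⟨x, rfl⟩ := Nat.exists_eq_add_of_le' hx
  obtain ⟨y, rfl⟩ := Nat.exists_eq_add_of_le' hy
  ring_nf at ht
  linarith [Nat.zero_le (w * x), Nat.zero_le (w * x * y), Nat.zero_le (w * x * y * z),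
    Nat.zero_le (w * x * z), Nat.zero_le (w * y), Nat.zero_le (w * y * z), Nat.zero_le (w * z),
    Nat.zero_le (x * y), Nat.zero_le (x * y * z), Nat.zero_le (x * z), Nat.zero_le (y * z)]

/-- A path blow-up with vanishing first class and the spectral invariants of `K_{r+1,q}⁺` has,
up to reversal of the remaining path on four vertices, the class sizes of `K_{r+1,q}⁺` or of
`K_{x+1,y+1}⁻` together with isolated vertices. -/
theorem class_sizes_of_invariants {r q w x y z : ℕ} (hr : 2 ≤ r) (hq : 3 ≤ q)
    (ht : w * x + x * y + y * z = (r + 1) * q + 1) (hs : w * x * y * z = r * q) :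
    (w = 1 ∧ x = 1 ∧ y = q ∧ z = r) ∨ (z = 1 ∧ y = 1 ∧ x = q ∧ w = r) ∨
      (w = 1 ∧ z = 1 ∧ x + y = q + 1 ∧ x * y = r * q) := by
  have hpos : w * x * y * z ≠ 0 := by rw [hs]; positivity
  have hw : 1 ≤ w := Nat.one_le_iff_ne_zero.2 (by rintro rfl; simp at hpos)
  have hx : 1 ≤ x := Nat.one_le_iff_ne_zero.2 (by rintro rfl; simp at hpos)
  have hy : 1 ≤ y := Nat.one_le_iff_ne_zero.2 (by rintro rfl; simp at hpos)
  have hz : 1 ≤ z := Nat.one_le_iff_ne_zero.2 (by rintro rfl; simp at hpos)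
  have ht' : w * x + x * y + y * z = w * x * y * z + q + 1 := by rw [ht, hs]; ring
  have hq0 : 0 < q := by omega
  rcases eq_or_lt_of_le hw with rfl | hw2
  · rcases eq_or_lt_of_le hz with rfl | hz2
    · exact Or.inr (Or.inr ⟨rfl, rfl, by linarith, by linarith⟩)
    · obtain ⟨rfl, rfl⟩ := eq_one_and_eq_of_two_le hq hx hy hz2 (by linarith)
      exact Or.inl ⟨rfl, rfl, rfl, Nat.eq_of_mul_eq_mul_right hq0 (by linarith)⟩
  · obtain rfl : z = 1 := (eq_one_or_eq_one_of_sum_eq_prod_add hq0 hw hx hy hz ht').resolve_left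
      (by omega)
    obtain ⟨rfl, rfl⟩ := eq_one_and_eq_of_two_le hq hy hx hw2 (by linarith)
    exact Or.inr (Or.inl ⟨rfl, rfl, rfl, Nat.eq_of_mul_eq_mul_right hq0 (by linarith)⟩)

theorem eq_or_eq_of_add_eq_of_mul_eq {x y x' y' : ℕ} (h : x + y = x' + y') (h' : x * y = x' * y') :
    (x = x' ∧ y = y') ∨ (x = y' ∧ y = x') := by
  zify at *
  have : ((x : ℤ) - x') * (x - y') = 0 := by linear_combination x * h - h'
  rcases mul_eq_zero.1 this with h0 | h0
  · exact Or.inl ⟨by linarith, by linarith⟩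
  · exact Or.inr ⟨by linarith, by linarith⟩

theorem IsPathBlowup.exists_adj_of_eq_zero {V : Type*} [Fintype V] {G : SimpleGraph V}
    {m c n b : ℕ} (hG : IsPathBlowup G ![0, m, c, n, b, 0])
    (hm : m ≠ 0) (hc : c ≠ 0) (hn : n ≠ 0) (v : V) : ∃ w, G.Adj v w := by
  obtain ⟨f, hf, hfk⟩ := hG
  have hne : ∀ i, ![0, m, c, n, b, 0] i ≠ 0 → ∃ w, f w = i := fun i hi => by
    rw [← hfk] at hi
    obtain ⟨w, hw⟩ := Finset.card_pos.1 (Nat.pos_of_ne_zero hi)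
    exact ⟨w, by simpa using hw⟩
  obtain ⟨w₁, h₁⟩ := hne 1 hm
  obtain ⟨w₂, h₂⟩ := hne 2 hc
  obtain ⟨w₃, h₃⟩ := hne 3 hn
  have hv : ![0, m, c, n, b, 0] (f v) ≠ 0 := by
    rw [← hfk]
    exact Finset.card_ne_zero_of_mem (a := v) (by simp)
  simp only [hf]
  generalize f v = i at hv ⊢
  fin_cases i
  · exact absurd rfl hv
  · exact ⟨w₂, by simp [h₂, PathAdj]⟩
  · exact ⟨w₁, by simp [h₁, PathAdj]⟩
  · exact ⟨w₂, by simp [h₂, PathAdj]⟩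
  · exact ⟨w₃, by simp [h₃, PathAdj]⟩
  · exact absurd rfl hv

theorem Cospectral.exists_isPathBlowup {G : SimpleGraph V} {H : SimpleGraph W} {k : Fin 6 → ℕ}
    (hG : IsPathBlowup G k) (h : Cospectral G H) :
    ∃ a m c n b i, IsPathBlowup H ![a, m, c, n, b, i] := by
  refine exists_isPathBlowup_of_rank_le (h.rank_eq ▸ hG.rank_le) ?_
  rw [← trace_adjMat_pow_three_eq_zero_iff, ← h.trace_pow_eq,
    trace_adjMat_pow_three_eq_zero_iff]
  exact hG.not_adj_of_adj_adj

theorem KpqPlus_iso_or_iso_of_cospectral {r q x y : ℕ} (hr : 2 ≤ r) (hrq : r + 1 ≤ q)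
    (hsum : x + y = q + 1) (hprod : x * y = r * q) {H : SimpleGraph W}
    (h : Cospectral (KpqPlus (r + 1) q) H) :
    Nonempty (KpqPlus (r + 1) q ≃g H) ∨
      Nonempty (addIsolated (KpqMinus (x + 1) (y + 1)) (r - 1) ≃g H) := by
  have hP := isPathBlowup_KpqPlus r q
  have hM := isPathBlowup_addIsolated_KpqMinus x y (r - 1)
  obtain ⟨a, m, c, n, b, i, hH⟩ := h.exists_isPathBlowup hP
  obtain ⟨hN, ht, hs⟩ := (hP.cospectral_iff hH).1 h
  have hq : 3 ≤ q := by omega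
  have hab : a = 0 ∨ b = 0 := by
    refine eq_zero_or_eq_zero_of_sum_eq_prod_add (q := q) (m := m) (c := c) (n := n) ?_ ?_
      (by omega)
    · rw [← hs]; simp; omega
    · rw [← hs, ← ht]; ring
  clear h
  wlog ha : a = 0 generalizing a m c n b
  · exact this b n c m a hH.reverse (by linarith) (by linarith) (by rw [hs]; ring) hab.symm
      (hab.resolve_left ha)
  subst ha
  rcases class_sizes_of_invariants hr hq (w := m) (x := c) (y := n) (z := b)
    (by linear_combination -ht) (by linear_combination -hs)
    with ⟨rfl, rfl, rfl, rfl⟩ | ⟨rfl, rfl, rfl, rfl⟩ | ⟨rfl, rfl, h1, h2⟩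
  · obtain rfl : i = 0 := by omega
    exact Or.inl (hP.nonempty_iso hH)
  · obtain rfl : i = 0 := by omega
    exact Or.inl (hP.nonempty_iso hH.reverse_of_eq_zero)
  · obtain rfl : i = r - 1 := by omega
    right
    rcases eq_or_eq_of_add_eq_of_mul_eq (h1.trans hsum.symm) (h2.trans hprod.symm) with
      ⟨rfl, rfl⟩ | ⟨rfl, rfl⟩
    · exact hM.nonempty_iso hH.reverse_of_eq_zero
    · exact hM.nonempty_iso hH

end Characterization

/-- For integers `3 ≤ p ≤ q`, if `x² − (q+3)x + (pq+2)` has two integer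
roots `2 ≤ p'' ≤ q''`, then every graph cospectral with `K_{p,q}⁺` is isomorphic to
`K_{p,q}⁺` or to `K_{p'',q''}⁻ ∪ (p−2)K₁`; moreover the latter is cospectral with and
not isomorphic to `K_{p,q}⁺`. -/
theorem KpqPlus_cospectral_characterization (p q p'' q'' : ℕ) (hp : 3 ≤ p) (hpq : p ≤ q)
    (h2 : 2 ≤ p'') (hpq'' : p'' ≤ q'')
    (hsum : p'' + q'' = q + 3) (hprod : p'' * q'' = p * q + 2) :
    (∀ (W : Type u) [Fintype W] [DecidableEq W] (H : SimpleGraph W),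
      Cospectral (KpqPlus p q) H →
        Nonempty (KpqPlus p q ≃g H) ∨
        Nonempty (addIsolated (KpqMinus p'' q'') (p - 2) ≃g H)) ∧
    Cospectral (KpqPlus p q) (addIsolated (KpqMinus p'' q'') (p - 2)) ∧
    IsEmpty (KpqPlus p q ≃g addIsolated (KpqMinus p'' q'') (p - 2)) := by
  obtain ⟨r, rfl⟩ := Nat.exists_eq_add_of_le' (show 1 ≤ p by omega)
  obtain ⟨x, rfl⟩ := Nat.exists_eq_add_of_le' (show 1 ≤ p'' by omega)
  obtain ⟨y, rfl⟩ := Nat.exists_eq_add_of_le' (show 1 ≤ q'' by omega)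
  have hs : x + y = q + 1 := by omega
  have hp' : x * y = r * q := by linarith
  rw [show r + 1 - 2 = r - 1 by omega]
  have hP := isPathBlowup_KpqPlus r q
  have hM := isPathBlowup_addIsolated_KpqMinus x y (r - 1)
  refine ⟨fun W _ _ H h => KpqPlus_iso_or_iso_of_cospectral (by omega) hpq hs hp' h,
    (hP.cospectral_iff hM).2 ⟨by omega, by linarith, by linarith⟩, ⟨fun e => ?_⟩⟩
  obtain ⟨w, hw⟩ := hP.exists_adj_of_eq_zero one_ne_zero one_ne_zero (by omega)
    (e.symm (Sum.inr ⟨0, by omega⟩))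
  have hw' := e.map_adj_iff.2 hw
  rw [RelIso.apply_symm_apply] at hw'
  simp [addIsolated] at hw'
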